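/- Let G be a group, let k ≥ 2, and let y_1, …, y_k ∈ G satisfy BR(y_i, y_{i+1}) for 1 ≤ i < k and CM(y_i, y_j) for 1 ≤ i < j−1 ≤ k−1. Let w := y_1 y_2 ⋯ y_{k−1} y_k y_{k−1}^{−1} ⋯ y_2^{−1} y_1^{−1}. Then BR(y_1, w) and BR(y_k, w); moreover, if k ≥ 3 then BR(y_k, v), where v := y_{k−1}^{−1} ⋯ y_2^{−1} y_1 y_2 ⋯ y_{k−1}. -/

import Mathlib

/- Scaffolding: braid/commuting predicates, ordered products, cycle and twisted
cycle commutators, and the Artin groups of the diagrams `Δ_n`, `Δ_{t,n}`, `D_n`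
(generators numbered `1, …, n` as in the paper, realized on the index type `Fin n`). -/

namespace ArtinPaper

open scoped commutatorElement

/-- `BR u v` : `u` and `v` braid, i.e. `u v u = v u v`. -/
def BR {G : Type*} [Group G] (u v : G) : Prop := u * v * u = v * u * v

/-- `CM u v` : `u` and `v` commute, i.e. `u v = v u`. -/
def CM {G : Type*} [Group G] (u v : G) : Prop := u * v = v * u

/-- `mulIcc y a b = y a * y (a+1) * ⋯ * y b` (equal to `1` when `a > b`). -/
def mulIcc {M : Type*} [Monoid M] (y : ℕ → M) (a b : ℕ) : M :=
  ((List.range (b + 1 - a)).map fun i => y (a + i)).prod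

/-- The cycle commutator
`cc(y₁,…,yₙ) = [y₁, y₂ ⋯ y_{n-1} yₙ y_{n-1}⁻¹ ⋯ y₂⁻¹]`. -/
def cc {G : Type*} [Group G] (y : ℕ → G) (n : ℕ) : G :=
  ⁅y 1, mulIcc y 2 (n - 1) * y n * (mulIcc y 2 (n - 1))⁻¹⁆

/-- The `t`-twisted cycle commutator
`tc_t(y₁,…,yₙ) = [y₁, y₂⁻¹ ⋯ y_{t+1}⁻¹ y_{t+2} ⋯ y_{n-1} yₙ y_{n-1}⁻¹ ⋯ y_{t+2}⁻¹ y_{t+1} ⋯ y₂]`.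
(The twisted cycle commutator `tc(y₁,y₂,y₃,y₄)` is `tc y 4 1`.) -/
def tc {G : Type*} [Group G] (y : ℕ → G) (n t : ℕ) : G :=
  ⁅y 1, mulIcc (fun i => (y i)⁻¹) 2 (t + 1) *
      (mulIcc y (t + 2) (n - 1) * y n * (mulIcc y (t + 2) (n - 1))⁻¹) *
      (mulIcc (fun i => (y i)⁻¹) 2 (t + 1))⁻¹⁆

/-- The `i`-th generator (numbered `1, …, n`) of the free group on `Fin n`. -/
def gen (n i : ℕ) : FreeGroup (Fin n) :=
  if h : 0 < n then FreeGroup.of ⟨(i - 1) % n, Nat.mod_lt _ h⟩ else 1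

/-- The braid relator `u v u (v u v)⁻¹`. -/
def braidRel {G : Type*} [Group G] (u v : G) : G := u * v * u * (v * u * v)⁻¹

/-- Artin-type relations on generators `1, …, n` determined by an edge predicate `E`:
generators joined by an edge braid, all other pairs of generators commute. -/
def relsOf (n : ℕ) (E : ℕ → ℕ → Prop) : Set (FreeGroup (Fin n)) :=
  { w | ∃ i j, 1 ≤ i ∧ i < j ∧ j ≤ n ∧
      ((E i j ∧ w = braidRel (gen n i) (gen n j)) ∨
       (¬ E i j ∧ w = ⁅gen n i, gen n j⁆)) }

/-- Edges of the `n`-cycle `Δ_n`: `{i, i+1}` for `1 ≤ i ≤ n-1`, and `{1, n}`. -/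
def cycEdge (n i j : ℕ) : Prop := (1 ≤ i ∧ i + 1 ≤ n ∧ j = i + 1) ∨ (i = 1 ∧ j = n)

/-- Defining relations of the Artin group `A(Δ_n)` of the `n`-cycle. -/
def cycleRels (n : ℕ) : Set (FreeGroup (Fin n)) := relsOf n (cycEdge n)

/-- Edges of the diagram `Δ_{t,n}`, where `r = n - 3 - t` and the generators are
`b_1, …, b_{4+r}` (vertices `1, …, 4+r`) and `c_{5+r}, …, c_n` (vertices `5+r, …, n`):
the braiding pairs are `{b_1,b_2}, {b_2,b_3}, {b_3,b_1}, {b_4,b_1}, {b_1,b_5}`,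
`{b_i,b_{i+1}}` for `5 ≤ i ≤ 3+r`, `{b_3,c_{5+r}}`, and `{c_i,c_{i+1}}` for
`5+r ≤ i ≤ n-1`. -/
def deltaEdge (n t i j : ℕ) : Prop :=
  (i = 1 ∧ j = 2) ∨ (i = 2 ∧ j = 3) ∨ (i = 1 ∧ j = 3) ∨ (i = 1 ∧ j = 4) ∨
  (i = 1 ∧ j = 5 ∧ 5 ≤ 4 + (n - 3 - t)) ∨
  (5 ≤ i ∧ i + 1 ≤ 4 + (n - 3 - t) ∧ j = i + 1) ∨
  (i = 3 ∧ j = 5 + (n - 3 - t) ∧ 5 + (n - 3 - t) ≤ n) ∨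
  (5 + (n - 3 - t) ≤ i ∧ i + 1 ≤ n ∧ j = i + 1)

/-- Defining relations of the Artin group `A(Δ_{t,n})`. -/
def deltaRels (n t : ℕ) : Set (FreeGroup (Fin n)) := relsOf n (deltaEdge n t)

/-- Edges of the Coxeter diagram `D_n`: `{1,3}, {2,3}`, and `{i, i+1}` for
`3 ≤ i ≤ n-1` (in particular `1` and `2` are not joined, so `x_1 x_2 = x_2 x_1`). -/
def dEdge (n i j : ℕ) : Prop :=
  (i = 1 ∧ j = 3) ∨ (i = 2 ∧ j = 3) ∨ (3 ≤ i ∧ i + 1 ≤ n ∧ j = i + 1)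

/-- Defining relations of the Artin group `A(D_n)` of type `D_n`. -/
def dRels (n : ℕ) : Set (FreeGroup (Fin n)) := relsOf n (dEdge n)

/-- The Artin group `A(D_n)` of type `D_n`. -/
abbrev ArtinD (n : ℕ) := PresentedGroup (dRels n)

/-- `G_{n,t}`: the quotient of `A(Δ_n)` by the normal closure of the `t`-twisted
cycle commutator `tc_t(a_1, …, a_n)`. -/
abbrev Gnt (n t : ℕ) := PresentedGroup (cycleRels n ∪ {tc (gen n) n t})

/-- `Q_{n,t}`: the quotient of `A(Δ_{t,n})` by the normal closure of the twisted
cycle commutator `tc(b_1, b_2, b_3, b_4)`. -/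
abbrev Qnt (n t : ℕ) := PresentedGroup (deltaRels n t ∪ {tc (gen n) 4 1})

theorem mulIcc_of_lt {M : Type*} [Monoid M] (y : ℕ → M) {a b : ℕ} (h : b < a) :
    mulIcc y a b = 1 := by
  simp [mulIcc, Nat.sub_eq_zero_of_le h]

theorem mulIcc_succ_right {M : Type*} [Monoid M] (y : ℕ → M) {a b : ℕ} (h : a ≤ b + 1) :
    mulIcc y a (b + 1) = mulIcc y a b * y (b + 1) := by
  rw [mulIcc, mulIcc, Nat.sub_add_comm h, List.range_succ]
  simp [Nat.add_sub_of_le h]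

theorem mulIcc_eq_mul_left {M : Type*} [Monoid M] (y : ℕ → M) {a b : ℕ} (h : a ≤ b) :
    mulIcc y a b = y a * mulIcc y (a + 1) b := by
  rw [mulIcc, mulIcc, Nat.sub_add_comm h, Nat.add_sub_add_right, List.range_succ_eq_map]
  simp [Function.comp_def, Nat.add_assoc, Nat.add_comm 1]

theorem commute_mulIcc {M : Type*} [Monoid M] {y : ℕ → M} {a b : ℕ} {g : M}
    (h : ∀ i, a ≤ i → i ≤ b → Commute g (y i)) : Commute g (mulIcc y a b) := by
  refine Commute.list_prod_right _ _ fun x hx => ?_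
  obtain ⟨i, hi, rfl⟩ := List.mem_map.1 hx
  rw [List.mem_range] at hi
  exact h _ (by omega) (by omega)

theorem BR.symm {G : Type*} [Group G] {u v : G} (h : BR u v) : BR v u := Eq.symm h

theorem BR.conj {G : Type*} [Group G] {u v : G} (h : BR u v) (g : G) :
    BR (g * u * g⁻¹) (g * v * g⁻¹) := by
  simpa [BR, mul_assoc] using congrArg (g * · * g⁻¹) h

theorem BR.conj_of_commute {G : Type*} [Group G] {u v g : G} (h : BR u v)
    (hg : Commute u g) : BR u (g * v * g⁻¹) := by
  simpa [hg.symm.eq] using h.conj g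

theorem BR.conj_self {G : Type*} [Group G] {u v : G} (h : BR u v) :
    BR u (u * v * u⁻¹) :=
  h.conj_of_commute (Commute.refl u)

theorem BR.mul_mul_inv_eq {G : Type*} [Group G] {u v : G} (h : BR u v) :
    u * v * u⁻¹ = v⁻¹ * u * v := by
  rw [mul_inv_eq_iff_eq_mul, mul_assoc, mul_assoc, eq_inv_mul_iff_mul_eq, ← mul_assoc,
    ← mul_assoc]
  exact h.symm

/-- In a braid-type chain, conjugating the last element leftwards along the chain agrees with
conjugating the first element rightwards along it. -/
theorem mulIcc_conj_last_eq_conj_first {G : Type*} [Group G] {y : ℕ → G} {a b : ℕ} (hab : a ≤ b)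
    (hbr : ∀ i, a < i → i ≤ b → BR (y i) (y (i + 1)))
    (hcm : ∀ i j, a < i → i + 1 < j → j ≤ b + 1 → CM (y i) (y j)) :
    mulIcc y (a + 1) b * y (b + 1) * (mulIcc y (a + 1) b)⁻¹ =
      (mulIcc y (a + 2) (b + 1))⁻¹ * y (a + 1) * mulIcc y (a + 2) (b + 1) := by
  induction b, hab using Nat.le_induction with
  | base => simp [mulIcc_of_lt]
  | succ b hab ih =>
    have hc : Commute (y (b + 2)) (mulIcc y (a + 1) b) := commute_mulIcc fun i hi hib =>
      (hcm i (b + 2) hi (by omega) le_rfl).symm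
    have hb := (hbr (b + 1) (by omega) le_rfl).mul_mul_inv_eq
    specialize ih (fun i hi hib => hbr i hi (by omega)) fun i j hi hij hj =>
      hcm i j hi hij (by omega)
    rw [mulIcc_succ_right y (show a + 1 ≤ b + 1 by omega),
      mulIcc_succ_right y (show a + 2 ≤ b + 1 + 1 by omega)]
    calc
      _ = mulIcc y (a + 1) b * (y (b + 1) * y (b + 2) * (y (b + 1))⁻¹) *
          (mulIcc y (a + 1) b)⁻¹ := by group
      _ = mulIcc y (a + 1) b * (y (b + 2))⁻¹ * y (b + 1) *
          (y (b + 2) * (mulIcc y (a + 1) b)⁻¹) := by rw [hb]; group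
      _ = (y (b + 2))⁻¹ * (mulIcc y (a + 1) b * y (b + 1) * (mulIcc y (a + 1) b)⁻¹) *
          y (b + 2) := by rw [hc.inv_right.eq, ← hc.inv_left.eq]; group
      _ = _ := by rw [ih]; group

/-- Lemma 2.3(ii): with braid-group-like relations among
`y 1, …, y k` and `w = y₁ ⋯ y_{k-1} y_k y_{k-1}⁻¹ ⋯ y₁⁻¹`, we have `BR (y 1) w`,
`BR (y k) w` and, if `k ≥ 3`, also `BR (y k) v` where
`v = y_{k-1}⁻¹ ⋯ y₂⁻¹ y₁ y₂ ⋯ y_{k-1}`. -/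
theorem longconj_braids {G : Type*} [Group G] (k : ℕ) (hk : 2 ≤ k) (y : ℕ → G)
    (hbr : ∀ i, 1 ≤ i → i < k → BR (y i) (y (i + 1)))
    (hcm : ∀ i j, 1 ≤ i → i + 1 < j → j ≤ k → CM (y i) (y j)) :
    BR (y 1) (mulIcc y 1 (k - 1) * y k * (mulIcc y 1 (k - 1))⁻¹) ∧
    BR (y k) (mulIcc y 1 (k - 1) * y k * (mulIcc y 1 (k - 1))⁻¹) ∧
    (3 ≤ k → BR (y k) ((mulIcc y 2 (k - 1))⁻¹ * y 1 * mulIcc y 2 (k - 1))) := by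
  obtain ⟨m, rfl⟩ : ∃ m, k = m + 2 := ⟨k - 2, by omega⟩
  simp only [show m + 2 - 1 = m + 1 from rfl]
  have hv : BR (y (m + 2)) ((mulIcc y 2 (m + 1))⁻¹ * y 1 * mulIcc y 2 (m + 1)) := by
    rw [← mulIcc_conj_last_eq_conj_first (Nat.zero_le m)
      (fun i hi him => hbr i hi (by omega)) fun i j hi hij hj => hcm i j hi hij (by omega)]
    exact (hbr (m + 1) (by omega) (by omega)).symm.conj_of_commute <|
      commute_mulIcc fun i hi him => (hcm i (m + 2) (by omega) (by omega) le_rfl).symm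
  refine ⟨?_, ?_, fun _ => hv⟩
  · have hu : BR (y 1) (mulIcc y 2 (m + 1) * y (m + 2) * (mulIcc y 2 (m + 1))⁻¹) := by
      rw [mulIcc_conj_last_eq_conj_first (show 1 ≤ m + 1 by omega)
        (fun i hi him => hbr i (by omega) (by omega)) fun i j hi hij hj =>
          hcm i j (by omega) hij hj]
      have hc : Commute (y 1) (mulIcc y 3 (m + 2)) := commute_mulIcc fun i hi him =>
        hcm 1 i le_rfl (by omega) him
      simpa using (hbr 1 le_rfl (by omega)).conj_of_commute hc.inv_right
    rw [mulIcc_eq_mul_left y (show 1 ≤ m + 1 by omega)]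
    simpa [mul_assoc] using hu.conj_self
  · rw [mulIcc_conj_last_eq_conj_first (Nat.zero_le (m + 1))
      (fun i hi him => hbr i hi (by omega)) fun i j hi hij hj => hcm i j hi hij hj,
      mulIcc_succ_right y (show 0 + 2 ≤ m + 1 + 1 by omega)]
    simpa [mul_assoc] using
      hv.conj_of_commute (Commute.refl (y (m + 2))).inv_right

end ArtinPaper
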